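/- Let G be a finite normal-form game with N ≥ 2 players, let ℓ ≤ K be non-negative integers, and let σ ∈ Σ. If there exists a polynomial strategy-profile η : ℝ → ∏_n ℝ^{S_n} such that (a) η_{n,s_n} > 0 for each n and s_n ∈ S_n and o(η) ≤ ℓ, (b) η(0) = σ, and (c) σ_n is a best reply of order K against η for each player n, then there exists an LPS profile ϱ of order K over S such that ϱ has full support, ℓ(ϱ) ≤ ℓ (indeed ℓ(ϱ) can be taken equal to o(η)), ϱ_n^0 = σ_n for each n, and σ_n is a best reply of order K against ϱ for each n. -/

import Mathlib

namespace GamePE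

variable {N : ℕ}

/-- A (not necessarily mixed) strategy profile. -/
abbrev Profile (S : Fin N → Type) := ∀ n, S n → ℝ

/-- τ is a profile of mixed strategies. -/
def IsMixed {S : Fin N → Type} [∀ n, Fintype (S n)] (τ : Profile S) : Prop :=
  ∀ n, (∀ s, 0 ≤ τ n s) ∧ (∑ s, τ n s) = 1

/-- τ is completely mixed. -/
def CompletelyMixed {S : Fin N → Type} (τ : Profile S) : Prop := ∀ n s, 0 < τ n s

/-- The pure strategy sn viewed as a mixed strategy. -/
def pureStrat {S : Fin N → Type} [∀ n, DecidableEq (S n)] {n : Fin N} (sn : S n) : S n → ℝ :=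
  fun s => if s = sn then 1 else 0

/-- The multilinear extension of player n's payoff. -/
noncomputable def payoff {S : Fin N → Type} [∀ n, Fintype (S n)]
    (G : Fin N → (∀ m, S m) → ℝ) (n : Fin N) (τ : Profile S) : ℝ :=
  ∑ s : ∀ m, S m, (∏ m, τ m (s m)) * G n s

/-- σ is a perfect equilibrium of the game G. -/
noncomputable def IsPerfect {S : Fin N → Type} [∀ n, Fintype (S n)] [∀ n, DecidableEq (S n)]
    (G : Fin N → (∀ m, S m) → ℝ) (σ : Profile S) : Prop :=
  ∃ σk : ℕ → Profile S,
    (∀ k, IsMixed (σk k) ∧ CompletelyMixed (σk k)) ∧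
    Filter.Tendsto σk Filter.atTop (nhds σ) ∧
    (∀ (k : ℕ) (n : Fin N) (sn : S n),
      payoff G n (Function.update (σk k) n (σ n)) ≥
        payoff G n (Function.update (σk k) n (pureStrat sn)))

/-- ϱ is an LPS profile of order K : each level of each player is a probability distribution. -/
def IsLPSProfile {S : Fin N → Type} [∀ n, Fintype (S n)] {K : ℕ}
    (ϱ : ∀ n, Fin (K+1) → S n → ℝ) : Prop :=
  ∀ n k, (∀ s, 0 ≤ ϱ n k s) ∧ (∑ s, ϱ n k s) = 1

/-- Full support for an LPS profile. -/
def FullSupport {S : Fin N → Type} {K : ℕ} (ϱ : ∀ n, Fin (K+1) → S n → ℝ) : Prop :=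
  ∀ n, ∀ s : S n, ∃ k, ϱ n k s ≠ 0

/-- ℓ(ϱ) : the max over the players of the first level at which the union of supports is everything. -/
noncomputable def lpsLevel {S : Fin N → Type} [∀ n, Fintype (S n)] {K : ℕ}
    (ϱ : ∀ n, Fin (K+1) → S n → ℝ) : ℕ :=
  Finset.univ.sup fun n =>
    sInf {k : ℕ | ∀ s : S n, ∃ i : Fin (K+1), (i : ℕ) ≤ k ∧ ϱ n i s ≠ 0}

/-- Combine a pure strategy of player n with a pure strategy profile of the others. -/
def combine {S : Fin N → Type} (n : Fin N) (sn : S n)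
    (so : ∀ m : {m : Fin N // m ≠ n}, S m.val) : ∀ m, S m :=
  fun m => if h : m = n then cast (congrArg S h.symm) sn else so ⟨m, h⟩

/-- Unnormalized induced beliefs of player n at level k. -/
noncomputable def ubelief {S : Fin N → Type} [∀ n, Fintype (S n)] {K : ℕ}
    (ϱ : ∀ n, Fin (K+1) → S n → ℝ) (n : Fin N) (k : ℕ)
    (so : ∀ m : {m : Fin N // m ≠ n}, S m.val) : ℝ :=
  ∑ kv ∈ Finset.univ.filter
      (fun kv : {m : Fin N // m ≠ n} → Fin (K+1) => (∑ m, ((kv m : ℕ))) = k),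
    ∏ m : {m : Fin N // m ≠ n}, ϱ m.val (kv m) (so m)

/-- Induced beliefs μ_n^k of player n at level k (normalized). -/
noncomputable def belief {S : Fin N → Type} [∀ n, Fintype (S n)] {K : ℕ}
    (ϱ : ∀ n, Fin (K+1) → S n → ℝ) (n : Fin N) (k : ℕ)
    (so : ∀ m : {m : Fin N // m ≠ n}, S m.val) : ℝ :=
  (∑ so' : ∀ m : {m : Fin N // m ≠ n}, S m.val, ubelief ϱ n k so')⁻¹ * ubelief ϱ n k so

/-- Expected payoff of player n playing τn against a belief μ over the opponents' profiles. -/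
noncomputable def beliefPayoff {S : Fin N → Type} [∀ n, Fintype (S n)]
    (G : Fin N → (∀ m, S m) → ℝ) (n : Fin N) (τn : S n → ℝ)
    (μ : (∀ m : {m : Fin N // m ≠ n}, S m.val) → ℝ) : ℝ :=
  ∑ so : ∀ m : {m : Fin N // m ≠ n}, S m.val, ∑ sn : S n,
    μ so * τn sn * G n (combine n sn so)

/-- Lexicographic comparison of the first k+1 entries (indices 0,…,k) of two sequences. -/
def lexGe (k : ℕ) (a b : ℕ → ℝ) : Prop :=
  (∀ i ≤ k, a i = b i) ∨ ∃ i ≤ k, (∀ j < i, a j = b j) ∧ b i < a i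

/-- τn is a best reply of order k against the LPS profile ϱ. -/
noncomputable def lpsBestReply {S : Fin N → Type} [∀ n, Fintype (S n)] [∀ n, DecidableEq (S n)]
    (G : Fin N → (∀ m, S m) → ℝ) {K : ℕ} (ϱ : ∀ n, Fin (K+1) → S n → ℝ)
    (n : Fin N) (τn : S n → ℝ) (k : ℕ) : Prop :=
  ∀ sn : S n,
    lexGe k (fun i => beliefPayoff G n τn (belief ϱ n i))
            (fun i => beliefPayoff G n (pureStrat sn) (belief ϱ n i))

/-- A polynomial strategy profile. -/
abbrev PolyProfile (S : Fin N → Type) := ∀ n, S n → Polynomial ℝ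

/-- f > 0 for a univariate real polynomial: the trailing (lowest-order) coefficient is positive. -/
def polyPos (f : Polynomial ℝ) : Prop := 0 < f.trailingCoeff

/-- f ≥ 0 : f is identically zero or its trailing coefficient is positive. -/
def polyNonneg (f : Polynomial ℝ) : Prop := f = 0 ∨ 0 < f.trailingCoeff

/-- The order o(η) of a polynomial strategy profile (∞ if some coordinate is zero). -/
noncomputable def polyOrder {S : Fin N → Type} [∀ n, Fintype (S n)]
    (η : PolyProfile S) : ℕ∞ :=
  Finset.univ.sup fun p : Σ n, S n => (η p.1 p.2).trailingDegree

/-- The polynomial t ↦ G_n(τn, η_{-n}(t)). -/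
noncomputable def payoffPoly {S : Fin N → Type} [∀ n, Fintype (S n)]
    (G : Fin N → (∀ m, S m) → ℝ) (η : PolyProfile S) (n : Fin N) (τn : S n → ℝ) :
    Polynomial ℝ :=
  ∑ s : ∀ m, S m,
    (Polynomial.C (τn (s n)) * ∏ m ∈ Finset.univ.erase n, η m (s m)) * Polynomial.C (G n s)

/-- τn is a best reply of order r against the polynomial strategy profile η. -/
noncomputable def polyBestReply {S : Fin N → Type} [∀ n, Fintype (S n)] [∀ n, DecidableEq (S n)]
    (G : Fin N → (∀ m, S m) → ℝ) (η : PolyProfile S) (n : Fin N) (τn : S n → ℝ) (r : ℕ) : Prop :=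
  ∀ sn : S n,
    polyNonneg (payoffPoly G η n τn - payoffPoly G η n (pureStrat sn)) ∨
    ((r + 1 : ℕ) : ℕ∞) ≤ (payoffPoly G η n τn - payoffPoly G η n (pureStrat sn)).trailingDegree


open Filter Topology

section Series

open PowerSeries

lemma coeff_mul_eq_zero_of_lt {f : PowerSeries ℝ} {o : ℕ} (hf : ∀ j < o, coeff j f = 0)
    (g : PowerSeries ℝ) {k : ℕ} (hk : k < o) : coeff k (f * g) = 0 := by
  rw [coeff_mul]
  refine Finset.sum_eq_zero fun p hp => ?_
  rw [Finset.HasAntidiagonal.mem_antidiagonal] at hp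
  rw [hf p.1 (by omega), zero_mul]

lemma coeff_mul_of_coeff_eq_zero {f : PowerSeries ℝ} {o : ℕ} (hf : ∀ j < o, coeff j f = 0)
    (g : PowerSeries ℝ) : coeff o (f * g) = coeff o f * constantCoeff g := by
  rw [coeff_mul, Finset.sum_eq_single (o, 0)]
  · simp
  · intro p hp hne
    rw [Finset.HasAntidiagonal.mem_antidiagonal] at hp
    have : p.1 ≠ o := fun h => hne (Prod.ext h (by simp; omega))
    rw [hf p.1 (by omega), zero_mul]
  · simp

lemma coeff_mul_mk_one (f : PowerSeries ℝ) (k : ℕ) :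
    coeff k (f * PowerSeries.mk 1) = ∑ j ∈ Finset.range (k + 1), coeff j f := by
  rw [coeff_mul, Finset.Nat.sum_antidiagonal_eq_sum_range_succ_mk]
  simp

/-- A partial sum of a power series takes the sign of its lowest coefficient near `0` on the
right. -/
lemma eventually_partial_sum_pos {a : ℕ → ℝ} {o : ℕ} (ha : ∀ j < o, a j = 0) (hpos : 0 < a o)
    {k : ℕ} (hk : o ≤ k) :
    ∀ᶠ ε in 𝓝[>] (0 : ℝ), 0 < ∑ j ∈ Finset.range (k + 1), ε ^ j * a j := by
  obtain ⟨d, rfl⟩ := Nat.exists_eq_add_of_le hk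
  have hsum : ∀ ε : ℝ, ∑ j ∈ Finset.range (o + d + 1), ε ^ j * a j
      = ε ^ o * ∑ i ∈ Finset.range (d + 1), ε ^ i * a (o + i) := by
    intro ε
    rw [add_assoc, Finset.sum_range_add, Finset.sum_eq_zero, zero_add, Finset.mul_sum]
    · exact Finset.sum_congr rfl fun i _ => by ring
    · intro j hj
      rw [ha j (Finset.mem_range.1 hj), mul_zero]
  have hcont : Continuous fun ε : ℝ => ∑ i ∈ Finset.range (d + 1), ε ^ i * a (o + i) := by
    fun_prop
  have h0 : 0 < ∑ i ∈ Finset.range (d + 1), (0 : ℝ) ^ i * a (o + i) := by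
    rw [Finset.sum_range_succ']
    simpa using hpos
  filter_upwards [(hcont.continuousAt.eventually (lt_mem_nhds h0)).filter_mono
    nhdsWithin_le_nhds, self_mem_nhdsWithin] with ε h1 h2
  rw [hsum]
  exact mul_pos (pow_pos h2 _) h1

end Series

section Beliefs

open PowerSeries

variable {S : Fin N → Type}

lemma combine_self (n : Fin N) (sn : S n) (so : ∀ m : {m : Fin N // m ≠ n}, S m.val) :
    combine n sn so n = sn := by
  simp [combine]

lemma combine_of_ne (n : Fin N) (sn : S n) (so : ∀ m : {m : Fin N // m ≠ n}, S m.val)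
    (m : {m : Fin N // m ≠ n}) : combine n sn so m = so m := by
  simp [combine, m.2]

/-- A pure strategy profile is the same as a strategy of one player and a profile of the others. -/
def combineEquiv (n : Fin N) :
    ((∀ m : {m : Fin N // m ≠ n}, S m.val) × S n) ≃ (∀ m, S m) where
  toFun p := combine n p.2 p.1
  invFun s := (fun m => s m, s n)
  left_inv p := Prod.ext (funext fun m => combine_of_ne n p.2 p.1 m) (combine_self n p.2 p.1)
  right_inv s := by
    funext m
    by_cases h : m = n
    · subst h
      exact combine_self _ _ _
    · exact combine_of_ne n _ _ ⟨m, h⟩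

variable [∀ n, Fintype (S n)] {K : ℕ}

lemma ubelief_eq_coeff_prod {ϱ : ∀ n, Fin (K + 1) → S n → ℝ} {F : ∀ n, S n → PowerSeries ℝ}
    (hF : ∀ n k s, ϱ n k s = coeff (k : ℕ) (F n s)) (n : Fin N) {i : ℕ} (hi : i ≤ K)
    (so : ∀ m : {m : Fin N // m ≠ n}, S m.val) :
    ubelief ϱ n i so = coeff i (∏ m : {m : Fin N // m ≠ n}, F m.val (so m)) := by
  classical
  rw [coeff_prod, ubelief]
  refine Finset.sum_bij' (fun kv _ => Finsupp.equivFunOnFinite.symm fun m => (kv m : ℕ))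
    (fun l _ m => Fin.ofNat (K + 1) (l m)) ?_ ?_ ?_ ?_ ?_
  · intro kv hkv
    simpa [Finset.mem_finsuppAntidiag] using hkv
  · intro l hl
    rw [Finset.mem_finsuppAntidiag] at hl
    rw [Finset.mem_filter]
    refine ⟨Finset.mem_univ _, ?_⟩
    rw [← hl.1]
    refine Finset.sum_congr rfl fun m _ => ?_
    have hm : l m ≤ Finset.univ.sum l :=
      Finset.single_le_sum (fun _ _ => Nat.zero_le _) (Finset.mem_univ m)
    exact Nat.mod_eq_of_lt (by omega)
  · intro kv hkv
    funext m
    simp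
  · intro l hl
    rw [Finset.mem_finsuppAntidiag] at hl
    ext m
    have hm : l m ≤ Finset.univ.sum l :=
      Finset.single_le_sum (fun _ _ => Nat.zero_le _) (Finset.mem_univ m)
    exact Nat.mod_eq_of_lt (by omega)
  · intro kv hkv
    exact Finset.prod_congr rfl fun m _ => hF _ _ _

lemma sum_ubelief_pos {ϱ : ∀ n, Fin (K + 1) → S n → ℝ} (hϱ : IsLPSProfile ϱ) (hN : 2 ≤ N)
    (n : Fin N) {i : ℕ} (hi : i ≤ K) :
    0 < ∑ so : ∀ m : {m : Fin N // m ≠ n}, S m.val, ubelief ϱ n i so := by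
  classical
  have hcard : ∑ so : ∀ m : {m : Fin N // m ≠ n}, S m.val, ubelief ϱ n i so
      = ((Finset.univ.filter (fun kv : {m : Fin N // m ≠ n} → Fin (K + 1) =>
          (∑ m, ((kv m : ℕ))) = i)).card : ℝ) := by
    simp only [ubelief]
    rw [Finset.sum_comm, Finset.card_eq_sum_ones, Nat.cast_sum]
    refine Finset.sum_congr rfl fun kv _ => ?_
    rw [← Fintype.prod_sum fun (m : {m : Fin N // m ≠ n}) s => ϱ m.val (kv m) s]
    simp [(hϱ _ _).2]
  rw [hcard, Nat.cast_pos, Finset.card_pos]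
  have : Nontrivial (Fin N) := Fin.nontrivial_iff_two_le.2 hN
  obtain ⟨m, hm⟩ := exists_ne n
  refine ⟨Pi.single ⟨m, hm⟩ (Fin.ofNat (K + 1) i), ?_⟩
  rw [Finset.mem_filter]
  refine ⟨Finset.mem_univ _, ?_⟩
  rw [Finset.sum_eq_single ⟨m, hm⟩]
  · rw [Pi.single_eq_same]
    exact Nat.mod_eq_of_lt (Nat.lt_succ_of_le hi)
  · intro b _ hb
    simp [Pi.single_eq_of_ne hb]
  · simp

lemma beliefPayoff_belief (G : Fin N → (∀ m, S m) → ℝ) (ϱ : ∀ n, Fin (K + 1) → S n → ℝ)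
    (n : Fin N) (τ : S n → ℝ) (i : ℕ) :
    beliefPayoff G n τ (belief ϱ n i)
      = (∑ so : ∀ m : {m : Fin N // m ≠ n}, S m.val, ubelief ϱ n i so)⁻¹
        * beliefPayoff G n τ (ubelief ϱ n i) := by
  simp only [beliefPayoff, belief, Finset.mul_sum, mul_assoc]

/-- Payoffs against unnormalized beliefs are the coefficients of the payoff polynomial, rescaled and
multiplied by a power series. -/
lemma beliefPayoff_ubelief (G : Fin N → (∀ m, S m) → ℝ) {ϱ : ∀ n, Fin (K + 1) → S n → ℝ}
    (η : PolyProfile S) (ε : ℝ) (U : Fin N → PowerSeries ℝ)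
    (hϱ : ∀ n k s, ϱ n k s = coeff (k : ℕ) (rescale ε (η n s : PowerSeries ℝ) * U n))
    (n : Fin N) (τ : S n → ℝ) {i : ℕ} (hi : i ≤ K) :
    beliefPayoff G n τ (ubelief ϱ n i)
      = coeff i (rescale ε (payoffPoly G η n τ : PowerSeries ℝ)
          * ∏ m : {m : Fin N // m ≠ n}, U m.val) := by
  have hpoly : payoffPoly G η n τ
      = ∑ so : ∀ m : {m : Fin N // m ≠ n}, S m.val, ∑ sn : S n,
          Polynomial.C (τ sn * G n (combine n sn so))
            * ∏ m : {m : Fin N // m ≠ n}, η m.val (so m) := by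
    rw [payoffPoly, ← (combineEquiv n).sum_comp, Fintype.sum_prod_type]
    refine Finset.sum_congr rfl fun so _ => Finset.sum_congr rfl fun sn _ => ?_
    have hprod : ∏ m ∈ Finset.univ.erase n, η m (combine n sn so m)
        = ∏ m : {m : Fin N // m ≠ n}, η m.val (so m) := by
      rw [Finset.prod_subtype (p := fun m => m ≠ n) _ (by simp)]
      exact Finset.prod_congr rfl fun m _ => by rw [combine_of_ne]
    simp only [combineEquiv, Equiv.coe_fn_mk, combine_self, hprod, Polynomial.C_mul]
    ring
  have hcast : rescale ε (payoffPoly G η n τ : PowerSeries ℝ)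
      = ∑ so : ∀ m : {m : Fin N // m ≠ n}, S m.val, ∑ sn : S n,
          PowerSeries.C (τ sn * G n (combine n sn so))
            * ∏ m : {m : Fin N // m ≠ n}, rescale ε (η m.val (so m) : PowerSeries ℝ) := by
    have hC : ∀ c : ℝ, rescale ε (PowerSeries.C c) = PowerSeries.C c := by
      intro c
      ext k
      rw [coeff_rescale, PowerSeries.coeff_C]
      split_ifs with h <;> simp [h]
    rw [hpoly]
    simp only [← Polynomial.coeToPowerSeries.ringHom_apply, map_sum, map_mul, map_prod]
    simp only [Polynomial.coeToPowerSeries.ringHom_apply, Polynomial.coe_C, hC]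
  rw [hcast, beliefPayoff, Finset.sum_mul, map_sum]
  refine Finset.sum_congr rfl fun so _ => ?_
  rw [Finset.sum_mul, map_sum]
  refine Finset.sum_congr rfl fun sn _ => ?_
  rw [ubelief_eq_coeff_prod hϱ n hi, mul_assoc, mul_assoc, ← Finset.prod_mul_distrib,
    PowerSeries.coeff_C_mul]
  ring

lemma lpsBestReply_of_polyBestReply [∀ n, DecidableEq (S n)] (hN : 2 ≤ N)
    (G : Fin N → (∀ m, S m) → ℝ) {ϱ : ∀ n, Fin (K + 1) → S n → ℝ} (hLPS : IsLPSProfile ϱ)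
    (η : PolyProfile S) {ε : ℝ} (hε : 0 < ε) (U : Fin N → PowerSeries ℝ)
    (hU : ∀ n, constantCoeff (U n) = 1)
    (hϱ : ∀ n k s, ϱ n k s = coeff (k : ℕ) (rescale ε (η n s : PowerSeries ℝ) * U n))
    {n : Fin N} {τ : S n → ℝ} (hτ : polyBestReply G η n τ K) :
    lpsBestReply G ϱ n τ K := by
  intro sn
  set f := payoffPoly G η n τ - payoffPoly G η n (pureStrat sn) with hf
  set c : ℕ → ℝ := fun i =>
    (∑ so : ∀ m : {m : Fin N // m ≠ n}, S m.val, ubelief ϱ n i so)⁻¹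
  have hdiff : ∀ i ≤ K, beliefPayoff G n τ (belief ϱ n i)
      - beliefPayoff G n (pureStrat sn) (belief ϱ n i)
      = c i * coeff i (rescale ε (f : PowerSeries ℝ)
          * ∏ m : {m : Fin N // m ≠ n}, U m.val) := by
    intro i hi
    rw [beliefPayoff_belief, beliefPayoff_belief, beliefPayoff_ubelief G η ε U hϱ n _ hi,
      beliefPayoff_ubelief G η ε U hϱ n _ hi, ← mul_sub, ← map_sub, ← sub_mul, ← map_sub, hf,
      Polynomial.coe_sub]
  have hlow : ∀ o : ℕ, (o : ℕ∞) ≤ f.trailingDegree →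
      ∀ j < o, coeff j (rescale ε (f : PowerSeries ℝ)) = 0 := by
    intro o ho j hj
    rw [coeff_rescale, Polynomial.coeff_coe, Polynomial.coeff_eq_zero_of_lt_trailingDegree
      (lt_of_lt_of_le (by exact_mod_cast hj) ho), mul_zero]
  have heq : ∀ o : ℕ, (o : ℕ∞) ≤ f.trailingDegree → ∀ j < o, j ≤ K →
      beliefPayoff G n τ (belief ϱ n j) = beliefPayoff G n (pureStrat sn) (belief ϱ n j) := by
    intro o ho j hj hjK
    rw [← sub_eq_zero, hdiff j hjK, coeff_mul_eq_zero_of_lt (hlow o ho) _ hj, mul_zero]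
  by_cases hK : ((K + 1 : ℕ) : ℕ∞) ≤ f.trailingDegree
  · exact Or.inl fun i hi => heq _ hK i (by omega) hi
  obtain h | h := (hτ sn).resolve_right hK
  · rw [← hf] at h
    exact absurd (by simp [h]) hK
  rw [← hf] at h
  have hf0 : f ≠ 0 := by
    rintro h0
    simp [h0] at h
  have hdeg := Polynomial.trailingDegree_eq_natTrailingDegree hf0
  have hle : f.natTrailingDegree ≤ K := by
    rw [hdeg, Nat.cast_le] at hK
    omega
  refine Or.inr ⟨f.natTrailingDegree, hle, fun j hj => heq _ hdeg.ge j hj (by omega), ?_⟩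
  rw [← sub_pos, hdiff _ hle, coeff_mul_of_coeff_eq_zero (hlow _ hdeg.ge), map_prod]
  simp only [hU, Finset.prod_const_one, mul_one, coeff_rescale, Polynomial.coeff_coe]
  exact mul_pos (inv_pos.2 (sum_ubelief_pos hLPS hN n hle)) (mul_pos (pow_pos hε _) h)

lemma lpsLevel_eq_polyOrder [∀ n, Nonempty (S n)] {ϱ : ∀ n, Fin (K + 1) → S n → ℝ}
    {η : PolyProfile S} (hη : ∀ n s, η n s ≠ 0)
    (hdeg : ∀ n s, (η n s).natTrailingDegree ≤ K)
    (hsupp : ∀ n (k : Fin (K + 1)) s, ϱ n k s ≠ 0 ↔ (η n s).natTrailingDegree ≤ k) :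
    (lpsLevel ϱ : ℕ∞) = polyOrder η := by
  have hlevel : ∀ n, sInf {k : ℕ | ∀ s : S n, ∃ i : Fin (K + 1), (i : ℕ) ≤ k ∧ ϱ n i s ≠ 0}
      = Finset.univ.sup fun s : S n => (η n s).natTrailingDegree := by
    intro n
    have : {k : ℕ | ∀ s : S n, ∃ i : Fin (K + 1), (i : ℕ) ≤ k ∧ ϱ n i s ≠ 0}
        = Set.Ici (Finset.univ.sup fun s : S n => (η n s).natTrailingDegree) := by
      ext k
      simp only [Set.mem_ofPred_eq, Set.mem_Ici, Finset.sup_le_iff, Finset.mem_univ, true_imp_iff,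
        hsupp]
      refine forall_congr' fun s => ⟨fun ⟨i, h1, h2⟩ => h2.trans h1, fun h => ?_⟩
      exact ⟨⟨_, Nat.lt_succ_of_le (hdeg n s)⟩, h, le_rfl⟩
    rw [this, csInf_Ici]
  simp only [lpsLevel, hlevel, polyOrder,
    fun p : Σ n, S n => Polynomial.trailingDegree_eq_natTrailingDegree (hη p.1 p.2)]
  apply le_antisymm
  · have hle : ∀ B : ℕ, (∀ p : Σ n, S n, (η p.1 p.2).natTrailingDegree ≤ B) →
        (Finset.univ.sup fun n => Finset.univ.sup fun s : S n => (η n s).natTrailingDegree) ≤ B :=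
      fun B hB => Finset.sup_le fun n _ => Finset.sup_le fun s _ => hB ⟨n, s⟩
    by_cases htop : (Finset.univ.sup fun p : Σ n, S n =>
        ((η p.1 p.2).natTrailingDegree : ℕ∞)) = ⊤
    · rw [htop]
      exact le_top
    · lift (Finset.univ.sup fun p : Σ n, S n =>
        ((η p.1 p.2).natTrailingDegree : ℕ∞)) to ℕ using htop with B hB
      rw [Nat.cast_le]
      refine hle B fun p => ?_
      rw [← Nat.cast_le (α := ℕ∞), hB]
      exact Finset.le_sup (f := fun p : Σ n, S n => ((η p.1 p.2).natTrailingDegree : ℕ∞))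
        (Finset.mem_univ p)
  · refine Finset.sup_le fun p _ => Nat.cast_le.2 ?_
    exact (Finset.le_sup (f := fun s : S p.1 => (η p.1 s).natTrailingDegree)
      (Finset.mem_univ p.2)).trans
      (Finset.le_sup (f := fun n => Finset.univ.sup fun s : S n => (η n s).natTrailingDegree)
        (Finset.mem_univ p.1))

end Beliefs

/-- from a polynomial strategy-profile to an LPS profile. -/
theorem stmt5 {N : ℕ} (hN : 2 ≤ N) (S : Fin N → Type) [∀ n, Fintype (S n)]
    [∀ n, DecidableEq (S n)] [∀ n, Nonempty (S n)]
    (G : Fin N → (∀ m, S m) → ℝ) (ℓ K : ℕ) (hℓK : ℓ ≤ K)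
    (σ : Profile S) (hσ : IsMixed σ)
    (η : PolyProfile S)
    (hpos : ∀ n (sn : S n), polyPos (η n sn)) (hord : polyOrder η ≤ (ℓ : ℕ∞))
    (h0 : ∀ n (sn : S n), (η n sn).eval 0 = σ n sn)
    (hbr : ∀ n, polyBestReply G η n (σ n) K) :
    ∃ ϱ : ∀ n, Fin (K+1) → S n → ℝ,
      IsLPSProfile ϱ ∧ FullSupport ϱ ∧
      (lpsLevel ϱ : ℕ∞) = polyOrder η ∧ lpsLevel ϱ ≤ ℓ ∧
      (∀ n, ϱ n 0 = σ n) ∧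
      (∀ n, lpsBestReply G ϱ n (σ n) K) := by
  have hη : ∀ n s, η n s ≠ 0 := fun n s h => by
    have := hpos n s
    simp [polyPos, h] at this
  have hdegℓ : ∀ n s, (η n s).natTrailingDegree ≤ ℓ := fun n s => by
    have : (η n s).trailingDegree ≤ polyOrder η :=
      Finset.le_sup (f := fun p : Σ n, S n => (η p.1 p.2).trailingDegree)
        (Finset.mem_univ ⟨n, s⟩)
    have := this.trans hord
    rwa [Polynomial.trailingDegree_eq_natTrailingDegree (hη n s), Nat.cast_le] at this
  have hdeg : ∀ n s, (η n s).natTrailingDegree ≤ K := fun n s => (hdegℓ n s).trans hℓK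
  set D : Fin N → PowerSeries ℝ := fun n => ∑ s, (η n s : PowerSeries ℝ) with hD
  have hη0 : ∀ n s, PowerSeries.constantCoeff (η n s : PowerSeries ℝ) = σ n s := fun n s => by
    rw [Polynomial.constantCoeff_coe, ← h0, Polynomial.coeff_zero_eq_eval_zero]
  have hD0 : ∀ n, PowerSeries.constantCoeff (D n) = 1 := fun n => by
    simp only [hD, map_sum, hη0, (hσ n).2]
  have hDinv : ∀ n, PowerSeries.constantCoeff (D n)⁻¹ = 1 := fun n => by
    rw [PowerSeries.constantCoeff_inv, hD0, inv_one]
  have hlow : ∀ n s, ∀ j < (η n s).natTrailingDegree,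
      PowerSeries.coeff j (η n s : PowerSeries ℝ) = 0 := fun n s j hj => by
    rw [Polynomial.coeff_coe, Polynomial.coeff_eq_zero_of_lt_natTrailingDegree hj]
  have hpartial : ∀ᶠ ε in 𝓝[>] (0 : ℝ), ∀ n (k : Fin (K + 1)) (s : S n),
      (η n s).natTrailingDegree ≤ k →
      0 < ∑ j ∈ Finset.range (k + 1),
        ε ^ j * PowerSeries.coeff j ((η n s : PowerSeries ℝ) * (D n)⁻¹) := by
    refine eventually_all.2 fun n => eventually_all.2 fun k => eventually_all.2 fun s =>
      eventually_imp_distrib_left.2 fun hk => ?_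
    refine eventually_partial_sum_pos
      (fun j hj => coeff_mul_eq_zero_of_lt (hlow n s) _ hj) ?_ hk
    rw [coeff_mul_of_coeff_eq_zero (hlow n s), hDinv, mul_one, Polynomial.coeff_coe]
    exact hpos n s
  obtain ⟨ε, hε, hε0⟩ := (hpartial.and self_mem_nhdsWithin).exists
  change 0 < ε at hε0
  set U : Fin N → PowerSeries ℝ := fun n =>
    PowerSeries.rescale ε (D n)⁻¹ * PowerSeries.mk 1 with hU
  set ϱ : ∀ n, Fin (K + 1) → S n → ℝ := fun n k s =>
    PowerSeries.coeff (k : ℕ) (PowerSeries.rescale ε (η n s : PowerSeries ℝ) * U n) with hϱ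
  have hU0 : ∀ n, PowerSeries.constantCoeff (U n) = 1 := fun n => by
    rw [hU, map_mul, ← PowerSeries.coeff_zero_eq_constantCoeff_apply,
      PowerSeries.coeff_rescale, PowerSeries.coeff_zero_eq_constantCoeff_apply, hDinv]
    simp [PowerSeries.constantCoeff_mk]
  have hϱ_sum : ∀ n (k : Fin (K + 1)) s, ϱ n k s = ∑ j ∈ Finset.range (k + 1),
      ε ^ j * PowerSeries.coeff j ((η n s : PowerSeries ℝ) * (D n)⁻¹) := fun n k s => by
    simp only [hϱ, hU]
    rw [← mul_assoc, ← map_mul, coeff_mul_mk_one]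
    simp only [PowerSeries.coeff_rescale]
  have hϱ_pos : ∀ n (k : Fin (K + 1)) s, (η n s).natTrailingDegree ≤ k → 0 < ϱ n k s :=
    fun n k s h => by
      rw [hϱ_sum]
      exact hε n k s h
  have hϱ_zero : ∀ n (k : Fin (K + 1)) s, (k : ℕ) < (η n s).natTrailingDegree → ϱ n k s = 0 :=
    fun n k s h => coeff_mul_eq_zero_of_lt
      (fun j hj => by rw [PowerSeries.coeff_rescale, hlow n s j hj, mul_zero]) _ h
  have hsupp : ∀ n (k : Fin (K + 1)) s, ϱ n k s ≠ 0 ↔ (η n s).natTrailingDegree ≤ k :=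
    fun n k s => ⟨fun h => not_lt.1 fun hlt => h (hϱ_zero n k s hlt),
      fun h => (hϱ_pos n k s h).ne'⟩
  have hLPS : IsLPSProfile ϱ := by
    refine fun n k => ⟨fun s => ?_, ?_⟩
    · rcases lt_or_ge (k : ℕ) (η n s).natTrailingDegree with h | h
      · exact (hϱ_zero n k s h).ge
      · exact (hϱ_pos n k s h).le
    · have hsum : ∑ s, PowerSeries.rescale ε (η n s : PowerSeries ℝ) * U n
          = PowerSeries.mk 1 := by
        rw [← Finset.sum_mul, ← map_sum, hU, ← mul_assoc, ← map_mul,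
          PowerSeries.mul_inv_cancel _ (by rw [hD0]; exact one_ne_zero), map_one, one_mul]
      simp only [hϱ]
      rw [← map_sum, hsum, PowerSeries.coeff_mk, Pi.one_apply]
  have hlevel := lpsLevel_eq_polyOrder hη hdeg hsupp
  refine ⟨ϱ, hLPS, fun n s => ⟨Fin.ofNat (K + 1) (η n s).natTrailingDegree, ?_⟩, hlevel, ?_, ?_,
    fun n => lpsBestReply_of_polyBestReply hN G hLPS η hε0 U hU0 (fun _ _ _ => rfl) (hbr n)⟩
  · rw [hsupp]
    exact (Nat.mod_eq_of_lt (Nat.lt_succ_of_le (hdeg n s))).ge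
  · rw [← Nat.cast_le (α := ℕ∞), hlevel]
    exact hord
  · intro n
    funext s
    rw [hϱ_sum]
    simp [hη0, hDinv]

end GamePE
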